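/- Let G be a connected finite simple graph such that for every pair of distinct vertices u, v at distance exactly two in G there exist k pairwise internally vertex-disjoint u,v-paths. Then every vertex cut of G has size at least k; that is, for every set X of vertices whose removal disconnects G, |X| ≥ k. -/

import Mathlib

/-- There exist `k` pairwise internally vertex-disjoint paths from `u` to `v`:
paths sharing no vertices other than the endpoints `u` and `v`. -/
def HasKInternallyDisjointPaths {V : Type*} (G : SimpleGraph V) (u v : V) (k : ℕ) : Prop :=
  ∃ P : Fin k → G.Walk u v,
    (∀ i, (P i).IsPath) ∧
    ∀ i j, i ≠ j →
      ∀ w, w ∈ (P i).support → w ∈ (P j).support → w = u ∨ w = v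

/-- A vertex set `A` whose outer boundary lies in `X` can be left by a walk only through `X`. -/
theorem SimpleGraph.Walk.exists_mem_support_of_boundary_subset {V : Type*} {G : SimpleGraph V}
    {A X : Set V} (hA : ∀ a ∈ A, ∀ b ∉ A, G.Adj a b → b ∈ X) {u v : V} (p : G.Walk u v)
    (hu : u ∈ A) (hv : v ∉ A) : ∃ w ∈ p.support, w ∈ X := by
  obtain ⟨d, hd, h₁, h₂⟩ := p.exists_boundary_dart A hu hv
  exact ⟨d.snd, p.dart_snd_mem_support_of_mem_darts hd, hA _ h₁ _ h₂ d.adj⟩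

/-- Distinct nonadjacent vertices with a common neighbour are at distance two. -/
theorem SimpleGraph.dist_eq_two_of_common_neighbor {V : Type*} {G : SimpleGraph V} {u v x : V}
    (hne : u ≠ v) (hadj : ¬ G.Adj u v) (hu : G.Adj u x) (hv : G.Adj x v) : G.dist u v = 2 := by
  let p : G.Walk u v := .cons hu (.cons hv .nil)
  have h₂ : G.dist u v ≤ 2 := G.dist_le p
  have h₀ : G.dist u v ≠ 0 := fun h => hne (p.reachable.dist_eq_zero_iff.mp h)
  have h₁ : G.dist u v ≠ 1 := fun h => hadj (SimpleGraph.dist_eq_one_iff_adj.mp h)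
  omega

/-- A finite set met by every `u`-`v` walk and avoiding `u` and `v` has at least as many elements
as there are internally disjoint paths from `u` to `v`. -/
theorem HasKInternallyDisjointPaths.le_card {V : Type*} {G : SimpleGraph V} {u v : V} {k : ℕ}
    (h : HasKInternallyDisjointPaths G u v k) {X : Finset V} (hu : u ∉ X) (hv : v ∉ X)
    (hX : ∀ p : G.Walk u v, ∃ w ∈ p.support, w ∈ X) : k ≤ X.card := by
  obtain ⟨P, -, hP⟩ := h
  choose f hf hfX using fun i => hX (P i)
  have hinj : Function.Injective f := by
    intro i j hij
    by_contra hne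
    rcases hP i j hne (f i) (hf i) (hij ▸ hf j) with h | h
    · exact hu (h ▸ hfX i)
    · exact hv (h ▸ hfX i)
  simpa using Finset.card_le_card_of_injOn (s := Finset.univ) (t := X) f
    (fun i _ => hfX i) hinj.injOn

/-- If vertices at distance two are joined by `k` internally disjoint paths, then a finite set
containing the outer boundary of `A` and separating `A` from some other vertex has at least `k`
elements. -/
theorem SimpleGraph.Connected.le_card_of_boundary_subset {V : Type*} {G : SimpleGraph V}
    (hG : G.Connected) {k : ℕ}
    (h : ∀ u v : V, u ≠ v → G.dist u v = 2 → HasKInternallyDisjointPaths G u v k)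
    (X : Finset V) (A : Set V) (hAX : ∀ a ∈ A, a ∉ X) (hA : A.Nonempty)
    (hB : ∃ b, b ∉ A ∧ b ∉ X) (hbd : ∀ a ∈ A, ∀ b ∉ A, G.Adj a b → b ∈ X) : k ≤ X.card := by
  classical
  induction X using Finset.induction_on generalizing A with
  | empty =>
    obtain ⟨a, ha⟩ := hA
    obtain ⟨b, hb, -⟩ := hB
    obtain ⟨p⟩ := hG.preconnected a b
    obtain ⟨w, -, hw⟩ := p.exists_mem_support_of_boundary_subset (X := ∅)
      (fun a ha b hb hab => by simpa using hbd a ha b hb hab) ha hb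
    exact hw.elim
  | insert x X hx ih =>
    by_cases hxA : ∃ u ∈ A, G.Adj u x
    · by_cases hxB : ∃ v, v ∉ A ∧ v ∉ insert x X ∧ G.Adj x v
      · obtain ⟨u, hu, hux⟩ := hxA
        obtain ⟨v, hv, hvX, hxv⟩ := hxB
        have hne : u ≠ v := fun e => hv (e ▸ hu)
        have hd := SimpleGraph.dist_eq_two_of_common_neighbor hne
          (fun e => hvX (hbd u hu v hv e)) hux hxv
        exact (h u v hne hd).le_card (hAX u hu) hvX
          fun p => p.exists_mem_support_of_boundary_subset hbd hu hv
      · refine (ih (insert x A) ?_ (Set.insert_nonempty _ _) ?_ ?_).trans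
          (Finset.card_le_card (Finset.subset_insert x X))
        · grind
        · grind
        · grind
    · refine (ih A ?_ hA ?_ ?_).trans (Finset.card_le_card (Finset.subset_insert x X))
      · grind
      · grind
      · grind

/-- If every pair of distinct vertices at distance exactly two in a connected
finite graph `G` is joined by `k` internally disjoint paths, then every vertex
cut of `G` has size at least `k`. -/
theorem vertexCut_card_ge_of_distTwo_disjoint_paths {V : Type*} [Fintype V]
    (G : SimpleGraph V) (hG : G.Connected) (k : ℕ)
    (h : ∀ u v : V, u ≠ v → G.dist u v = 2 → HasKInternallyDisjointPaths G u v k) :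
    ∀ X : Finset V, ¬ (G.induce ((X : Set V)ᶜ)).Preconnected → k ≤ X.card := by
  intro X hX
  simp only [SimpleGraph.Preconnected, not_forall] at hX
  obtain ⟨a, b, hab⟩ := hX
  refine hG.le_card_of_boundary_subset h X
    {v | ∃ hv : v ∈ (X : Set V)ᶜ, (G.induce ((X : Set V)ᶜ)).Reachable a ⟨v, hv⟩} ?_
    ⟨a, a.2, .rfl⟩ ⟨b, fun ⟨_, hb⟩ => hab hb, b.2⟩ ?_
  · rintro v ⟨hv, -⟩
    exact hv
  · rintro v ⟨hv, hav⟩ w hw hvw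
    by_contra hwX
    have hadj : (G.induce ((X : Set V)ᶜ)).Adj ⟨v, hv⟩ ⟨w, hwX⟩ := hvw
    exact hw ⟨hwX, hav.trans hadj.reachable⟩
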